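/- Suppose additionally that f preserves m (i.e., the pushforward of m under f equals m). Then f is ergodic with respect to m if and only if there exists an SRB measure ν of f whose basin of attraction has full measure, m(A(ν)) = 1; and in that case ν = m. -/

import Mathlib

open MeasureTheory Filter Topology ENNReal NNReal

variable {M : Type*} [MetricSpace M] [CompactSpace M] [MeasurableSpace M] [BorelSpace M]

/-- The empiric probability `E_{n+1}(x) = (1/(n+1)) ∑_{j=0}^{n} δ_{f^j(x)}`.
(The indexing is shifted: `empiric f x n` is the `(n+1)`-st empiric probability `E_{n+1}(x)`,
so that `(empiric f x n)_{n ≥ 0}` is exactly the sequence `(E_n(x))_{n ≥ 1}`.) -/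
noncomputable def empiric (f : M → M) (x : M) (n : ℕ) : ProbabilityMeasure M :=
  ⟨((n : ℝ≥0∞) + 1)⁻¹ • ∑ j ∈ Finset.range (n + 1), MeasureTheory.Measure.dirac (f^[j] x), by
    constructor
    rw [Measure.smul_apply, Measure.finset_sum_apply]
    simp only [Measure.dirac_apply_of_mem (Set.mem_univ _), Finset.sum_const,
      Finset.card_range, nsmul_eq_mul, mul_one, smul_eq_mul]
    rw [Nat.cast_add, Nat.cast_one]
    exact ENNReal.inv_mul_cancel (by simp) (by simp)⟩

/-- The limit set `pω(x)`: all weak* limits of convergent subsequences of the sequence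
of empiric probabilities `(E_n(x))_{n ≥ 1}`. -/
def pomega (f : M → M) (x : M) : Set (ProbabilityMeasure M) :=
  {μ | ∃ φ : ℕ → ℕ, StrictMono φ ∧ Tendsto (fun k => empiric f x (φ k)) atTop (𝓝 μ)}

/-- The Lévy–Prokhorov distance between two Borel probability measures. -/
noncomputable def probDist (μ ν : ProbabilityMeasure M) : ℝ :=
  levyProkhorovDist (μ : Measure M) (ν : Measure M)

/-- The basin of `ε`-attraction of `μ`:
`A_ε(μ) = {x ∈ M : inf_{ν ∈ pω(x)} dist(ν, μ) < ε}`. -/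
def basinEps (f : M → M) (μ : ProbabilityMeasure M) (ε : ℝ) : Set M :=
  {x | (⨅ ν ∈ pomega f x, probDist ν μ) < ε}

/-- `μ` is observable (SRB-like): for every `ε > 0`, the basin of `ε`-attraction of `μ`
has positive `m`-measure. -/
def Observable (f : M → M) (m : Measure M) (μ : ProbabilityMeasure M) : Prop :=
  ∀ ε : ℝ, 0 < ε → 0 < m (basinEps f μ ε)

/-- The basin of attraction `A(μ) = {x ∈ M : pω(x) = {μ}}`. -/
def basin (f : M → M) (μ : ProbabilityMeasure M) : Set M :=
  {x | pomega f x = {μ}}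

/-- `μ` is an SRB (physical) measure: its basin of attraction has positive `m`-measure. -/
def IsSRB (f : M → M) (m : Measure M) (μ : ProbabilityMeasure M) : Prop :=
  0 < m (basin f μ)

/-- The running maximum `max 0 (S₁ h) ⋯ (Sₙ h)` of the Birkhoff sums of `h`. -/
def birkhoffMax {X : Type*} (f : X → X) (h : X → ℝ) : ℕ → X → ℝ
  | 0, _ => 0
  | n + 1, x => max 0 (h x + birkhoffMax f h n (f x))

section BirkhoffMax

variable {X : Type*} {f : X → X} {h : X → ℝ}

theorem birkhoffMax_nonneg (n : ℕ) (x : X) : 0 ≤ birkhoffMax f h n x := by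
  cases n with
  | zero => exact le_rfl
  | succ n => exact le_max_left _ _

theorem birkhoffMax_le_succ (n : ℕ) (x : X) :
    birkhoffMax f h n x ≤ birkhoffMax f h (n + 1) x := by
  induction n generalizing x with
  | zero => exact birkhoffMax_nonneg _ _
  | succ n ih => exact max_le_max le_rfl (add_le_add le_rfl (ih (f x)))

theorem birkhoffSum_le_birkhoffMax (n : ℕ) (x : X) :
    birkhoffSum f h n x ≤ birkhoffMax f h n x := by
  induction n generalizing x with
  | zero => simp [birkhoffMax]
  | succ n ih =>
    rw [birkhoffSum_succ']
    exact (add_le_add le_rfl (ih (f x))).trans (le_max_right _ _)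

theorem bddAbove_birkhoffMax_comp_iff (x : X) :
    BddAbove (Set.range fun n => birkhoffMax f h n (f x)) ↔
      BddAbove (Set.range fun n => birkhoffMax f h n x) := by
  constructor
  · rintro ⟨C, hC⟩
    refine ⟨max 0 (h x + C), ?_⟩
    rintro _ ⟨n, rfl⟩
    refine (birkhoffMax_le_succ n x).trans ?_
    exact max_le_max le_rfl (add_le_add le_rfl (hC ⟨n, rfl⟩))
  · rintro ⟨C, hC⟩
    refine ⟨C - h x, ?_⟩
    rintro _ ⟨n, rfl⟩
    have h₁ : birkhoffMax f h (n + 1) x ≤ C := hC ⟨n + 1, rfl⟩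
    have h₂ : h x + birkhoffMax f h n (f x) ≤ birkhoffMax f h (n + 1) x := le_max_right _ _
    change birkhoffMax f h n (f x) ≤ C - h x
    linarith

theorem birkhoffMax_succ_sub (n : ℕ) (x : X) :
    birkhoffMax f h (n + 1) x - birkhoffMax f h n (f x) =
      max (-birkhoffMax f h n (f x)) (h x) := by
  change max 0 _ - _ = _
  rw [← max_sub_sub_right]
  simp

variable [MeasurableSpace X] {μ : Measure X}

theorem measurable_birkhoffMax (hf : Measurable f) (hh : Measurable h) (n : ℕ) :
    Measurable (birkhoffMax f h n) := by
  induction n with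
  | zero => exact measurable_const
  | succ n ih => exact measurable_const.max (hh.add (ih.comp hf))

theorem MeasureTheory.MeasurePreserving.integrable_birkhoffMax (hf : MeasurePreserving f μ μ)
    (hh : Integrable h μ) (n : ℕ) : Integrable (birkhoffMax f h n) μ := by
  induction n with
  | zero => exact integrable_zero _ _ _
  | succ n ih =>
    exact (integrable_zero X ℝ μ).sup (hh.add (hf.integrable_comp_of_integrable ih))

/-- The **maximal ergodic inequality** on the set where the Birkhoff sums are unbounded above. -/
theorem MeasureTheory.MeasurePreserving.setIntegral_nonneg_of_not_bddAbove_birkhoffMax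
    (hf : MeasurePreserving f μ μ) (hm : Measurable h) (hh : Integrable h μ) :
    0 ≤ ∫ x in {x | ¬ BddAbove (Set.range fun n => birkhoffMax f h n x)}, h x ∂μ := by
  set A := {x | ¬ BddAbove (Set.range fun n => birkhoffMax f h n x)}
  have hAm : MeasurableSet A :=
    (measurableSet_bddAbove_range (measurable_birkhoffMax hf.measurable hm)).compl
  have hAf : f ⁻¹' A = A := by
    ext x
    exact not_congr (bddAbove_birkhoffMax_comp_iff x)
  have hfA : MeasurePreserving f (μ.restrict A) (μ.restrict A) := by
    simpa only [hAf] using hf.restrict_preimage hAm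
  have hF (n : ℕ) := hfA.integrable_birkhoffMax hh.restrict n
  have hlim : Tendsto (fun n => ∫ x in A, max (-birkhoffMax f h n (f x)) (h x) ∂μ) atTop
      (𝓝 (∫ x in A, h x ∂μ)) := by
    refine tendsto_integral_of_dominated_convergence (fun x => |h x|) (fun n => ?_)
      hh.restrict.abs (fun n => ?_) ?_
    · exact (((measurable_birkhoffMax hf.measurable hm n).comp
        hf.measurable).neg.max hm).aestronglyMeasurable
    · refine ae_of_all _ fun x => ?_
      have h₀ := birkhoffMax_nonneg (f := f) (h := h) n (f x)
      rw [Real.norm_eq_abs, abs_le]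
      exact ⟨(neg_abs_le _).trans (le_max_right _ _),
        max_le (by linarith [abs_nonneg (h x)]) (le_abs_self _)⟩
    · filter_upwards [ae_restrict_mem hAm] with x hx
      rw [← hAf] at hx
      have htop : Tendsto (fun n => birkhoffMax f h n (f x)) atTop atTop :=
        tendsto_atTop_atTop_of_monotone' (monotone_nat_of_le_succ fun n =>
          birkhoffMax_le_succ n (f x)) hx
      refine tendsto_const_nhds.congr' ?_
      filter_upwards [htop.eventually_ge_atTop (-h x)] with n hn
      exact (max_eq_right (by linarith)).symm
  refine ge_of_tendsto' hlim fun n => ?_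
  simp_rw [← birkhoffMax_succ_sub]
  have hcomp : ∫ x in A, birkhoffMax f h n (f x) ∂μ = ∫ x in A, birkhoffMax f h n x ∂μ := by
    conv_rhs => rw [← hfA.map_eq]
    rw [integral_map hfA.aemeasurable]
    exact (measurable_birkhoffMax hf.measurable hm n).aestronglyMeasurable
  have hFf : Integrable (fun x => birkhoffMax f h n (f x)) (μ.restrict A) :=
    hfA.integrable_comp_of_integrable (hF n)
  rw [integral_sub (hF (n + 1)) hFf, hcomp, sub_nonneg]
  exact integral_mono (hF n) (hF (n + 1)) (birkhoffMax_le_succ n)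

theorem Ergodic.ae_bddAbove_birkhoffSum [IsProbabilityMeasure μ] (hf : Ergodic f μ)
    (hm : Measurable h) (hh : Integrable h μ) (hneg : ∫ x, h x ∂μ < 0) :
    ∀ᵐ x ∂μ, BddAbove (Set.range fun n => birkhoffSum f h n x) := by
  have hle := hf.toMeasurePreserving.setIntegral_nonneg_of_not_bddAbove_birkhoffMax hm hh
  set A := {x | ¬ BddAbove (Set.range fun n => birkhoffMax f h n x)}
  have hAm : MeasurableSet A :=
    (measurableSet_bddAbove_range (measurable_birkhoffMax hf.measurable hm)).compl
  have hAf : f ⁻¹' A = A := by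
    ext x
    exact not_congr (bddAbove_birkhoffMax_comp_iff x)
  rcases hf.toPreErgodic.ae_mem_or_ae_notMem hAm hAf with h₁ | h₁
  · rw [Measure.restrict_eq_self_of_ae_mem h₁] at hle
    exact absurd hle hneg.not_ge
  · filter_upwards [h₁] with x hx
    obtain ⟨C, hC⟩ := not_not.1 hx
    refine ⟨C, ?_⟩
    rintro _ ⟨n, rfl⟩
    exact (birkhoffSum_le_birkhoffMax n x).trans (hC ⟨n, rfl⟩)

theorem Ergodic.ae_eventually_birkhoffAverage_lt [IsProbabilityMeasure μ] (hf : Ergodic f μ)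
    (hm : Measurable h) (hh : Integrable h μ) {a : ℝ} (ha : ∫ x, h x ∂μ < a) :
    ∀ᵐ x ∂μ, ∀ᶠ n in atTop, birkhoffAverage ℝ f h n x < a := by
  obtain ⟨b, hb, hba⟩ := exists_between ha
  have hint : ∫ x, (h x - b) ∂μ < 0 := by
    rw [integral_sub hh (integrable_const _)]
    simpa using hb
  filter_upwards [hf.ae_bddAbove_birkhoffSum (hm.sub_const b) (hh.sub (integrable_const b)) hint]
    with x hx
  obtain ⟨C, hC⟩ := hx
  have hlim : Tendsto (fun n : ℕ => b + C / n) atTop (𝓝 (b + 0)) :=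
    tendsto_const_nhds.add (tendsto_const_div_atTop_nhds_zero_nat C)
  rw [add_zero] at hlim
  filter_upwards [hlim.eventually_lt_const hba, eventually_gt_atTop 0] with n hn hn0
  refine lt_of_le_of_lt ?_ hn
  have hn0' : (0 : ℝ) < n := Nat.cast_pos.2 hn0
  have h₁ : birkhoffSum f (fun x => h x - b) n x ≤ C := hC ⟨n, rfl⟩
  have h₂ : birkhoffSum f (fun x => h x - b) n x = birkhoffSum f h n x - n * b := by
    simp [birkhoffSum, Finset.sum_sub_distrib]
  rw [h₂] at h₁
  rw [birkhoffAverage, smul_eq_mul, inv_mul_le_iff₀ hn0']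
  field_simp
  linarith

/-- **Birkhoff's pointwise ergodic theorem** for ergodic maps. -/
theorem Ergodic.ae_tendsto_birkhoffAverage [IsProbabilityMeasure μ] (hf : Ergodic f μ)
    (hm : Measurable h) (hh : Integrable h μ) :
    ∀ᵐ x ∂μ, Tendsto (fun n => birkhoffAverage ℝ f h n x) atTop (𝓝 (∫ x, h x ∂μ)) := by
  have hup : ∀ᵐ x ∂μ, ∀ k : ℕ, ∀ᶠ n in atTop,
      birkhoffAverage ℝ f h n x < ∫ x, h x ∂μ + 1 / ((k : ℝ) + 1) :=
    ae_all_iff.2 fun k => hf.ae_eventually_birkhoffAverage_lt hm hh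
      (lt_add_of_pos_right _ Nat.one_div_pos_of_nat)
  have hlow : ∀ᵐ x ∂μ, ∀ k : ℕ, ∀ᶠ n in atTop,
      birkhoffAverage ℝ f (-h) n x < -∫ x, h x ∂μ + 1 / ((k : ℝ) + 1) :=
    ae_all_iff.2 fun k => hf.ae_eventually_birkhoffAverage_lt hm.neg hh.neg (by
      simp only [Pi.neg_apply, integral_neg]
      exact lt_add_of_pos_right _ Nat.one_div_pos_of_nat)
  filter_upwards [hup, hlow] with x h₁ h₂
  rw [Metric.tendsto_nhds]
  intro ε hε
  obtain ⟨k, hk⟩ := exists_nat_one_div_lt hε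
  filter_upwards [h₁ k, h₂ k] with n hn₁ hn₂
  rw [birkhoffAverage_neg] at hn₂
  simp only [Pi.neg_apply] at hn₂
  rw [Real.dist_eq, abs_lt]
  constructor <;> linarith

end BirkhoffMax

section Empiric

theorem integral_empiric (f : M → M) (x : M) (n : ℕ) (g : M → ℝ) :
    ∫ y, g y ∂(empiric f x n : Measure M) = birkhoffAverage ℝ f g (n + 1) x := by
  change ∫ y, g y ∂(((n : ℝ≥0∞) + 1)⁻¹ • ∑ j ∈ Finset.range (n + 1), Measure.dirac (f^[j] x)) = _
  rw [integral_smul_measure, integral_finsetSum_measure fun j _ => integrable_dirac (by simp)]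
  simp only [integral_dirac, birkhoffAverage, birkhoffSum]
  congr 1
  rw [ENNReal.toReal_inv, ENNReal.toReal_add (by simp) (by simp)]
  simp

theorem continuous_empiric {f : M → M} (hf : Continuous f) (n : ℕ) :
    Continuous fun x => empiric f x n := by
  refine continuous_iff_continuousAt.2 fun x => ?_
  refine ProbabilityMeasure.tendsto_iff_forall_integral_tendsto.2 fun g => ?_
  simp only [integral_empiric, birkhoffAverage, birkhoffSum]
  have hcont : Continuous fun y => ∑ j ∈ Finset.range (n + 1), g (f^[j] y) :=
    continuous_finsetSum _ fun j _ => g.continuous.comp (hf.iterate j)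
  exact (hcont.tendsto x).const_smul _

theorem mem_basin_iff {f : M → M} {ν : ProbabilityMeasure M} {x : M} :
    x ∈ basin f ν ↔ Tendsto (empiric f x) atTop (𝓝 ν) := by
  constructor
  · intro (hx : pomega f x = {ν})
    refine tendsto_of_subseq_tendsto fun ns hns => ?_
    obtain ⟨φ, hφ, hφm⟩ := strictMono_subseq_of_tendsto_atTop hns
    obtain ⟨μ, ψ, hψ, hμ⟩ := CompactSpace.tendsto_subseq fun k => empiric f x (ns (φ k))
    have hmem : μ ∈ pomega f x := ⟨fun k => ns (φ (ψ k)), hφm.comp hψ, hμ⟩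
    rw [hx, Set.mem_singleton_iff] at hmem
    exact ⟨fun k => φ (ψ k), hmem ▸ hμ⟩
  · intro hx
    refine Set.eq_singleton_iff_unique_mem.2 ⟨⟨id, strictMono_id, hx⟩, ?_⟩
    rintro μ ⟨φ, hφ, hμ⟩
    exact tendsto_nhds_unique hμ (hx.comp hφ.tendsto_atTop)

theorem measurableSet_basin {f : M → M} (hf : Continuous f) (ν : ProbabilityMeasure M) :
    MeasurableSet (basin f ν) := by
  let _ : MeasurableSpace (ProbabilityMeasure M) := borel _
  have : BorelSpace (ProbabilityMeasure M) := ⟨rfl⟩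
  have hset : basin f ν = {x | Tendsto (fun n => empiric f x n) atTop (𝓝 ν)} :=
    Set.ext fun x => mem_basin_iff
  rw [hset]
  exact measurableSet_tendsto _ fun n => (continuous_empiric hf n).measurable

theorem ae_mem_basin_iff {f : M → M} (hf : Continuous f) {m : Measure M} [IsProbabilityMeasure m]
    {ν : ProbabilityMeasure M} : (∀ᵐ x ∂m, x ∈ basin f ν) ↔ m (basin f ν) = 1 :=
  prob_compl_eq_zero_iff (measurableSet_basin hf ν)

/-- Weak convergence on a compact metric space may be tested on a dense set of functions. -/
theorem tendsto_of_forall_dense_integral_tendsto {μs : ℕ → ProbabilityMeasure M}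
    {μ : ProbabilityMeasure M} {S : Set C(M, ℝ)} (hS : Dense S)
    (h : ∀ g ∈ S, Tendsto (fun n => ∫ y, g y ∂(μs n : Measure M)) atTop
      (𝓝 (∫ y, g y ∂(μ : Measure M)))) :
    Tendsto μs atTop (𝓝 μ) := by
  have hint (ρ : ProbabilityMeasure M) (g : C(M, ℝ)) : Integrable g (ρ : Measure M) :=
    g.continuous.integrable_of_hasCompactSupport (HasCompactSupport.of_compactSpace g)
  have hlip (ρ : ProbabilityMeasure M) :
      LipschitzWith 1 fun g : C(M, ℝ) => ∫ y, g y ∂(ρ : Measure M) := by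
    refine LipschitzWith.of_dist_le_mul fun g g' => ?_
    rw [dist_eq_norm, ← integral_sub (hint ρ g) (hint ρ g')]
    refine (norm_integral_le_of_norm_le_const (C := dist g g') (ae_of_all _ fun y => ?_)).trans ?_
    · rw [← dist_eq_norm]
      exact ContinuousMap.dist_apply_le_dist y
    · simp
  have hclosed : IsClosed {g : C(M, ℝ) | Tendsto (fun n => ∫ y, g y ∂(μs n : Measure M)) atTop
      (𝓝 (∫ y, g y ∂(μ : Measure M)))} :=
    ((LipschitzWith.uniformEquicontinuous _ 1 fun n =>
      hlip (μs n)).equicontinuous).isClosed_setOfPred_tendsto (hlip μ).continuous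
  refine ProbabilityMeasure.tendsto_iff_forall_integral_tendsto.2 fun g => ?_
  exact hclosed.closure_subset_iff.2 h (hS g.toContinuousMap)

theorem Ergodic.ae_mem_basin {f : M → M} {m : Measure M} [IsProbabilityMeasure m]
    (hf : Ergodic f m) : ∀ᵐ x ∂m, x ∈ basin f ⟨m, inferInstance⟩ := by
  obtain ⟨S, hSc, hS⟩ := TopologicalSpace.exists_countable_dense C(M, ℝ)
  have hae : ∀ᵐ x ∂m, ∀ g ∈ S,
      Tendsto (fun n => birkhoffAverage ℝ f g n x) atTop (𝓝 (∫ y, g y ∂m)) :=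
    (ae_ball_iff hSc).2 fun g _ => hf.ae_tendsto_birkhoffAverage g.continuous.measurable
      (g.continuous.integrable_of_hasCompactSupport (HasCompactSupport.of_compactSpace g))
  filter_upwards [hae] with x hx
  refine mem_basin_iff.2 (tendsto_of_forall_dense_integral_tendsto hS fun g hg => ?_)
  simp only [integral_empiric]
  exact (hx g hg).comp (tendsto_add_atTop_nat 1)

/-- A finite invariant measure carried by the basin of `ν` is a multiple of `ν`. -/
theorem eq_smul_of_ae_mem_basin {f : M → M} {μ : Measure M} [IsFiniteMeasure μ]
    (hf : MeasurePreserving f μ μ) {ν : ProbabilityMeasure M} (h : ∀ᵐ x ∂μ, x ∈ basin f ν) :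
    μ = μ Set.univ • (ν : Measure M) := by
  have : IsFiniteMeasure (μ Set.univ • (ν : Measure M)) :=
    Measure.smul_finite _ (measure_ne_top _ _)
  refine ext_of_forall_integral_eq_of_IsFiniteMeasure fun g => ?_
  have hint : Integrable g μ := g.integrable μ
  have hcomp (j : ℕ) : ∫ x, g (f^[j] x) ∂μ = ∫ x, g x ∂μ := by
    conv_rhs => rw [← (hf.iterate j).map_eq]
    rw [integral_map (hf.iterate j).aemeasurable]
    exact g.continuous.aestronglyMeasurable
  have hintj (j : ℕ) : Integrable (fun x => g (f^[j] x)) μ :=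
    (hf.iterate j).integrable_comp_of_integrable hint
  have havg (n : ℕ) : ∫ x, birkhoffAverage ℝ f g (n + 1) x ∂μ = ∫ x, g x ∂μ := by
    simp only [birkhoffAverage, birkhoffSum, integral_smul,
      integral_finsetSum _ fun j _ => hintj j, hcomp]
    simp only [Finset.sum_const, Finset.card_range, nsmul_eq_mul, smul_eq_mul]
    exact inv_mul_cancel_left₀ (by positivity) _
  have hlim : Tendsto (fun n => ∫ x, birkhoffAverage ℝ f g (n + 1) x ∂μ) atTop
      (𝓝 (∫ _, (∫ y, g y ∂(ν : Measure M)) ∂μ)) := by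
    refine tendsto_integral_of_dominated_convergence (fun _ => ‖g‖) (fun n => ?_)
      (integrable_const _) (fun n => ae_of_all _ fun x => ?_) ?_
    · exact ((integrable_finsetSum _ fun j _ => hintj j).const_mul
        ((n + 1 : ℕ) : ℝ)⁻¹).aestronglyMeasurable
    · rw [← integral_empiric]
      exact g.norm_integral_le_norm _
    · filter_upwards [h] with x hx
      simpa only [integral_empiric] using
        ProbabilityMeasure.tendsto_iff_forall_integral_tendsto.1 (mem_basin_iff.1 hx) g
  simp only [havg] at hlim
  rw [tendsto_nhds_unique tendsto_const_nhds hlim, integral_const, integral_smul_measure,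
    Measure.real]

theorem eq_of_ae_mem_basin {f : M → M} {m : Measure M} [IsProbabilityMeasure m]
    (hf : MeasurePreserving f m m) {ν : ProbabilityMeasure M} (h : ∀ᵐ x ∂m, x ∈ basin f ν) :
    (ν : Measure M) = m := by
  have hm := eq_smul_of_ae_mem_basin hf h
  rw [measure_univ, one_smul] at hm
  exact hm.symm

theorem ergodic_of_ae_mem_basin {f : M → M} {m : Measure M} [IsProbabilityMeasure m]
    (hf : MeasurePreserving f m m) {ν : ProbabilityMeasure M} (h : ∀ᵐ x ∂m, x ∈ basin f ν) :
    Ergodic f m := by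
  refine ⟨hf, ⟨fun A hA hfA => ?_⟩⟩
  have hfr : MeasurePreserving f (m.restrict A) (m.restrict A) := by
    simpa only [hfA] using hf.restrict_preimage hA
  have hr := congrArg (fun μ : Measure M => μ Aᶜ)
    (eq_smul_of_ae_mem_basin hfr (ae_restrict_of_ae h))
  simp only [eq_of_ae_mem_basin hf h, Measure.restrict_apply hA.compl, Set.compl_inter_self,
    measure_empty, Measure.smul_apply, Measure.restrict_apply_univ, smul_eq_mul] at hr
  rw [eventuallyConst_set']
  rcases mul_eq_zero.1 hr.symm with h₀ | h₀
  · exact Or.inl (ae_eq_empty.2 h₀)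
  · exact Or.inr (ae_eq_univ.2 h₀)

end Empiric

/-- **SRB measures and ergodicity.** If `f` preserves `m`, then `f` is ergodic with
respect to `m` if and only if there exists an SRB measure `ν` of `f` whose basin of
attraction has full measure; and in that case `ν = m`. -/
theorem ergodic_iff_srb_full_basin (f : M → M) (hf : Continuous f) (m : Measure M)
    [IsProbabilityMeasure m] (hpres : MeasurePreserving f m m) :
    (Ergodic f m ↔ ∃ ν : ProbabilityMeasure M, IsSRB f m ν ∧ m (basin f ν) = 1) ∧
      (∀ ν : ProbabilityMeasure M, IsSRB f m ν → m (basin f ν) = 1 →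
        (ν : Measure M) = m) := by
  refine ⟨⟨fun h => ?_, ?_⟩, fun ν _ hν => eq_of_ae_mem_basin hpres ((ae_mem_basin_iff hf).2 hν)⟩
  · have hfull := (ae_mem_basin_iff hf).1 h.ae_mem_basin
    exact ⟨_, zero_lt_one.trans_eq hfull.symm, hfull⟩
  · rintro ⟨ν, _, hν⟩
    exact ergodic_of_ae_mem_basin hpres ((ae_mem_basin_iff hf).2 hν)
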